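/- (Doeblin condition for the averaged kernel.) Let ε > 0, let f : ℝ^d → ℝ^d be Borel measurable, and let P be the uniform-ball perturbation kernel associated to f and ε. Let a_1, …, a_n be Borel subsets of ℝ^d, set ă_i = a_i \ ⋃_{j ≠ i} a_j, and assume vol(ă_j) > 0 for every j. Let Q be an n × n real matrix such that for every pair (i, j), either Q_{ij} = 0, or Q_{ij} = vol(ă_j)/vol(B(0,ε)) and a_j ⊆ B(f(x), ε) for every x ∈ a_i. Let I be a nonempty subset of {1, …, n} and let N ≥ 1 be an integer such that for every index i and every j ∈ I there exists 1 ≤ m ≤ N with (Q^m)_{ij} > 0. Define the averaged kernel P̄(x, A) = (1/N) · Σ_{m=1}^{N} P^m(x, A). Then there exist a real number β > 0 and a probability measure φ on ℝ^d such that P̄(x, A) ≥ β · φ(A) for every x ∈ a_1 ∪ … ∪ a_n and every Borel set A. -/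

import Mathlib

open MeasureTheory Metric Set
open scoped ENNReal

/-- The one-step uniform-ball perturbation kernel: from `x`, jump to `f x` and disperse
uniformly on the `ε`-ball around `f x`. -/
noncomputable def ballKernel {d : ℕ} (ε : ℝ)
    (f : EuclideanSpace ℝ (Fin d) → EuclideanSpace ℝ (Fin d))
    (x : EuclideanSpace ℝ (Fin d)) : Measure (EuclideanSpace ℝ (Fin d)) :=
  (volume (ball (0 : EuclideanSpace ℝ (Fin d)) ε))⁻¹ • volume.restrict (ball (f x) ε)

/-- The `m`-step transition probabilities of a kernel `κ`. -/
noncomputable def iterP {X : Type*} [MeasurableSpace X] (κ : X → Measure X) :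
    ℕ → X → Set X → ℝ≥0∞
  | 0, x, A => A.indicator 1 x
  | m + 1, x, A => ∫⁻ y, iterP κ m y A ∂(κ x)

/-- If every positive entry `Q i j` of a nonnegative matrix forces the kernel `κ` to dominate
`b • μ.restrict (t j)` on `s i`, then every positive entry of a positive power of `Q` yields a
minorization of the corresponding iterate of `κ` by a positive multiple of `μ.restrict (t j)`. -/
theorem exists_mul_le_iterP {X ι : Type*} [MeasurableSpace X] [Fintype ι] [DecidableEq ι]
    {κ : X → Measure X} {μ : Measure X} {s t : ι → Set X} {Q : Matrix ι ι ℝ} {b : ℝ≥0∞}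
    (hb : b ≠ 0) (hb' : b ≠ ⊤) (hts : ∀ j, t j ⊆ s j)
    (ht : ∀ j, MeasurableSet (t j)) (hμ : ∀ j, μ (t j) ≠ 0) (hQ : ∀ i j, 0 ≤ Q i j)
    (hfin : ∀ i j, 0 < Q i j → μ (t j) ≠ ⊤)
    (hκ : ∀ i j, 0 < Q i j → ∀ x ∈ s i, b • μ.restrict (t j) ≤ κ x)
    {m : ℕ} (hm : 1 ≤ m) {i j : ι} (hpos : 0 < (Q ^ m) i j) :
    μ (t j) ≠ ⊤ ∧ ∃ c : ℝ≥0∞, c ≠ 0 ∧ c ≠ ⊤ ∧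
      ∀ x ∈ s i, ∀ A, MeasurableSet A → c * μ (A ∩ t j) ≤ iterP κ m x A := by
  induction m, hm using Nat.le_induction generalizing i with
  | base =>
    rw [pow_one] at hpos
    refine ⟨hfin i j hpos, b, hb, hb', fun x hx A hA => ?_⟩
    simp only [iterP]
    rw [lintegral_indicator_one hA]
    simpa [Measure.restrict_apply hA] using hκ i j hpos x hx A
  | succ m hm ih =>
    rw [pow_succ', Matrix.mul_apply] at hpos
    obtain ⟨k, -, hk⟩ := Finset.exists_lt_of_sum_lt (f := fun _ => (0 : ℝ)) (by simpa using hpos)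
    have hQk : 0 < Q i k := (hQ i k).lt_of_ne (by rintro h; simp [← h] at hk)
    obtain ⟨hj, c, hc, hc', hle⟩ := ih (pos_of_mul_pos_right hk (hQ i k))
    refine ⟨hj, b * μ (t k) * c, mul_ne_zero (mul_ne_zero hb (hμ k)) hc,
      ENNReal.mul_ne_top (ENNReal.mul_ne_top hb' (hfin i k hQk)) hc', fun x hx A hA => ?_⟩
    calc b * μ (t k) * c * μ (A ∩ t j)
        = b * ∫⁻ _ in t k, c * μ (A ∩ t j) ∂μ := by rw [setLIntegral_const]; ring
      _ ≤ b * ∫⁻ y in t k, iterP κ m y A ∂μ := by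
          gcongr 1
          exact setLIntegral_mono' (ht k) fun y hy => hle y (hts k hy) A hA
      _ = ∫⁻ y, iterP κ m y A ∂(b • μ.restrict (t k)) := by
          rw [lintegral_smul_measure, smul_eq_mul]
      _ ≤ iterP κ (m + 1) x A := lintegral_mono' (hκ i k hQk x hx) le_rfl

/-- **Doeblin condition for the averaged kernel.** Under the hypotheses of the
comparison lemma, if moreover every `j ∈ I` can be reached from any `i` in at most `N` steps
of `Q`, then the averaged kernel `P̄(x,A) = (1/N) Σ_{m=1}^N P^m(x,A)` satisfies a Doeblin
minorization `P̄(x, A) ≥ β φ(A)` on `a_1 ∪ … ∪ a_n` for some `β > 0` and a probability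
measure `φ`. -/
theorem doeblin_condition_averaged_kernel
    (d : ℕ) (ε : ℝ) (hε : 0 < ε)
    (f : EuclideanSpace ℝ (Fin d) → EuclideanSpace ℝ (Fin d)) (hf : Measurable f)
    (n : ℕ) (a : Fin n → Set (EuclideanSpace ℝ (Fin d)))
    (hameas : ∀ i, MeasurableSet (a i))
    (abreve : Fin n → Set (EuclideanSpace ℝ (Fin d)))
    (habreve : ∀ i, abreve i = a i \ ⋃ j ∈ ({i}ᶜ : Set (Fin n)), a j)
    (hvol : ∀ j, 0 < volume (abreve j))
    (Q : Matrix (Fin n) (Fin n) ℝ)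
    (hQ : ∀ i j, Q i j = 0 ∨
      (Q i j = (volume (abreve j)).toReal /
          (volume (ball (0 : EuclideanSpace ℝ (Fin d)) ε)).toReal ∧
        ∀ x ∈ a i, a j ⊆ ball (f x) ε))
    (I : Finset (Fin n)) (hI : I.Nonempty)
    (N : ℕ) (hN : 1 ≤ N)
    (hreach : ∀ i : Fin n, ∀ j ∈ I, ∃ m : ℕ, 1 ≤ m ∧ m ≤ N ∧ 0 < (Q ^ m) i j) :
    ∃ β : ℝ, 0 < β ∧
      ∃ φ : Measure (EuclideanSpace ℝ (Fin d)), IsProbabilityMeasure φ ∧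
        ∀ x ∈ ⋃ i, a i, ∀ A : Set (EuclideanSpace ℝ (Fin d)), MeasurableSet A →
          ENNReal.ofReal β * φ A ≤
            (N : ℝ≥0∞)⁻¹ * ∑ m ∈ Finset.Icc 1 N, iterP (ballKernel ε f) m x A := by
  have hball : volume (ball (0 : EuclideanSpace ℝ (Fin d)) ε) ≠ ⊤ := measure_ball_lt_top.ne
  have hball' : volume (ball (0 : EuclideanSpace ℝ (Fin d)) ε) ≠ 0 :=
    (measure_ball_pos volume _ hε).ne'
  have hsub : ∀ j, abreve j ⊆ a j := fun j => by rw [habreve]; exact sdiff_subset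
  have hmeas : ∀ j, MeasurableSet (abreve j) := fun j => by
    rw [habreve]
    exact (hameas j).diff (MeasurableSet.biUnion (Set.to_countable _) fun k _ => hameas k)
  have hQ0 : ∀ i j, 0 ≤ Q i j := fun i j => by
    rcases hQ i j with h | ⟨h, -⟩ <;> rw [h]
    positivity
  have hfin : ∀ i j, 0 < Q i j → volume (abreve j) ≠ ⊤ := fun i j hij htop => by
    rcases hQ i j with h | ⟨h, -⟩ <;> simp [h, htop] at hij
  have hκ : ∀ i j, 0 < Q i j → ∀ x ∈ a i,
      (volume (ball (0 : EuclideanSpace ℝ (Fin d)) ε))⁻¹ • volume.restrict (abreve j) ≤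
        ballKernel ε f x := fun i j hij x hx => by
    rcases hQ i j with h | ⟨-, h⟩
    · exact absurd h hij.ne'
    · have hres := Measure.restrict_mono_set (volume : Measure (EuclideanSpace ℝ (Fin d)))
        ((hsub j).trans (h x hx))
      intro A
      simp only [ballKernel, Measure.smul_apply, smul_eq_mul]
      gcongr
  obtain ⟨j, hj⟩ := hI
  choose m hm1 hmN hpos using fun i => hreach i j hj
  have key := fun i => exists_mul_le_iterP (ENNReal.inv_ne_zero.2 hball)
    (ENNReal.inv_ne_top.2 hball') hsub hmeas (fun j => (hvol j).ne') hQ0 hfin hκ (hm1 i) (hpos i)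
  have hjtop := (key j).1
  choose c hc hc' hle using fun i => (key i).2
  have : Nonempty (Fin n) := ⟨j⟩
  obtain ⟨i₀, hi₀⟩ := Finite.exists_min c
  have hN0 : (N : ℝ≥0∞)⁻¹ ≠ 0 := ENNReal.inv_ne_zero.2 (ENNReal.natCast_ne_top N)
  have hNtop : (N : ℝ≥0∞)⁻¹ ≠ ⊤ := ENNReal.inv_ne_top.2 (by exact_mod_cast (by omega : N ≠ 0))
  have hβ0 : (N : ℝ≥0∞)⁻¹ * (c i₀ * volume (abreve j)) ≠ 0 :=
    mul_ne_zero hN0 (mul_ne_zero (hc i₀) (hvol j).ne')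
  have hβtop : (N : ℝ≥0∞)⁻¹ * (c i₀ * volume (abreve j)) ≠ ⊤ :=
    ENNReal.mul_ne_top hNtop (ENNReal.mul_ne_top (hc' i₀) hjtop)
  refine ⟨_, ENNReal.toReal_pos hβ0 hβtop, ProbabilityTheory.cond volume (abreve j),
    ProbabilityTheory.cond_isProbabilityMeasure_of_finite (hvol j).ne' hjtop, fun x hx A hA => ?_⟩
  obtain ⟨i, hxi⟩ := mem_iUnion.1 hx
  rw [ENNReal.ofReal_toReal hβtop, ProbabilityTheory.cond_apply (hmeas j), mul_assoc]
  gcongr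
  calc c i₀ * volume (abreve j) * ((volume (abreve j))⁻¹ * volume (abreve j ∩ A))
      = c i₀ * volume (A ∩ abreve j) := by
        rw [mul_assoc, ENNReal.mul_inv_cancel_left (hvol j).ne' hjtop, inter_comm]
    _ ≤ c i * volume (A ∩ abreve j) := by gcongr; exact hi₀ i
    _ ≤ iterP (ballKernel ε f) (m i) x A := hle i x hxi A hA
    _ ≤ ∑ m ∈ Finset.Icc 1 N, iterP (ballKernel ε f) m x A :=
        Finset.single_le_sum (f := fun m => iterP (ballKernel ε f) m x A)
          (fun _ _ => zero_le) (Finset.mem_Icc.2 ⟨hm1 i, hmN i⟩)
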